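/- arXiv:math/0601732 — 6 statements merged into one kernel-verified Lean document; each statement's English description precedes it below -/
import Mathlib

section
/- Let m and n be positive integers. Define the real polynomial p(x) = ∏_{k=1}^{m} (x + (n/2 − k)(n/2 + k − 1)) and, for each natural number i, set λ_i = i(i + n − 1). Then for every natural number i, p(λ_i) = ∏_{k=0}^{2m−1} (i + n/2 − m + k). -/
theorem prod_Icc_sub_mul_add_sub_one {R : Type*} [CommRing R] (a : R) (m : ℕ) :
    ∏ k ∈ Finset.Icc 1 m, (a - k) * (a + k - 1) = ∏ k ∈ Finset.range (2 * m), (a - m + k) := by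
  induction m with
  | zero => simp
  | succ m ih =>
    have hshift : ∏ k ∈ Finset.range (2 * m), (a - (m + 1 : ℕ) + (k + 1 : ℕ)) =
        ∏ k ∈ Finset.range (2 * m), (a - m + k) :=
      Finset.prod_congr rfl fun k _ => by push_cast; ring
    rw [Finset.prod_Icc_succ_top (by omega), ih, mul_add_one 2 m, Finset.prod_range_succ,
      Finset.prod_range_succ', hshift]
    push_cast
    ring

/-- For `p(x) = ∏_{k=1}^{m} (x + (n/2 − k)(n/2 + k − 1))` and `λ_i = i(i + n − 1)`,
one has `p(λ_i) = ∏_{k=0}^{2m−1} (i + n/2 − m + k)`. -/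
theorem stmt_0 (m n : ℕ) (hm : 0 < m) (hn : 0 < n) (i : ℕ) :
    (∏ k ∈ Finset.Icc 1 m,
        (((i : ℝ) * (i + n - 1)) + ((n : ℝ) / 2 - k) * ((n : ℝ) / 2 + k - 1)))
      = ∏ k ∈ Finset.range (2 * m), ((i : ℝ) + (n : ℝ) / 2 - m + k) := by
  rw [← prod_Icc_sub_mul_add_sub_one]
  exact Finset.prod_congr rfl fun k _ => by ring
end

section
/- Let m and n be positive integers. With p(x) = ∏_{k=1}^{m} (x + (n/2 − k)(n/2 + k − 1)) and λ_i = i(i + n − 1), for every natural number i one has the recurrence (i + n/2 − m) · p(λ_{i+1}) = (i + n/2 + m) · p(λ_i). -/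
/-- The recurrence `(i + n/2 − m) · p(λ_{i+1}) = (i + n/2 + m) · p(λ_i)` for
`p(x) = ∏_{k=1}^{m} (x + (n/2 − k)(n/2 + k − 1))` and `λ_i = i(i + n − 1)`. -/
theorem stmt_2 (m n : ℕ) (hm : 0 < m) (hn : 0 < n) (i : ℕ) :
    ((i : ℝ) + (n : ℝ) / 2 - m) *
        (∏ k ∈ Finset.Icc 1 m,
          ((((i : ℝ) + 1) * ((i + 1 : ℝ) + n - 1)) + ((n : ℝ) / 2 - k) * ((n : ℝ) / 2 + k - 1)))
      = ((i : ℝ) + (n : ℝ) / 2 + m) *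
        (∏ k ∈ Finset.Icc 1 m,
          (((i : ℝ) * (i + n - 1)) + ((n : ℝ) / 2 - k) * ((n : ℝ) / 2 + k - 1))) := by
  clear hm
  induction m with
  | zero => simp
  | succ m ih =>
    rw [Finset.prod_Icc_succ_top (by lia), Finset.prod_Icc_succ_top (by lia)]
    push_cast at ih ⊢
    linear_combination
      (((i : ℝ) + (n : ℝ) / 2 - (m + 1)) * ((i : ℝ) + (n : ℝ) / 2 + (m + 1))) * ih
end

section
/- Let (m, n) be an admissible couple of positive integers, i.e. n > 1 and, in case n is even, n ≥ 2m. With p(x) = ∏_{k=1}^{m} (x + (n/2 − k)(n/2 + k − 1)) and λ_i = i(i + n − 1), for every natural number i one has the strict inequality |p(λ_{i+1})| > |p(λ_i)|. -/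
/-- The telescoping relation between `∏ (a - k) (a + k - 1)` and its shift by `a ↦ a + 1`. -/
theorem prod_Icc_shift_mul {R : Type*} [CommRing R] (a : R) (m : ℕ) :
    (∏ k ∈ Finset.Icc 1 m, (a + 1 - k) * (a + k)) * (a - m) =
      (∏ k ∈ Finset.Icc 1 m, (a - k) * (a + k - 1)) * (a + m) := by
  induction m with
  | zero => simp
  | succ m ih =>
    rw [Finset.prod_Icc_succ_top (by omega), Finset.prod_Icc_succ_top (by omega)]
    push_cast
    linear_combination (a + m + 1) * (a - m - 1) * ih

/-- If the shifted product does not vanish, it is strictly larger in absolute value. -/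
theorem abs_prod_Icc_lt_abs_prod_Icc_shift {R : Type*} [CommRing R] [LinearOrder R]
    [IsStrictOrderedRing R] {a : R} (ha : 0 < a) {m : ℕ} (hm : 0 < m)
    (hne : ∀ k ∈ Finset.Icc 1 m, a + 1 ≠ k) :
    |∏ k ∈ Finset.Icc 1 m, (a - k) * (a + k - 1)| <
      |∏ k ∈ Finset.Icc 1 m, (a + 1 - k) * (a + k)| := by
  have hm' : (0 : R) < m := Nat.cast_pos.mpr hm
  have hQ : 0 < |∏ k ∈ Finset.Icc 1 m, (a + 1 - k) * (a + k)| :=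
    abs_pos.mpr <| Finset.prod_ne_zero_iff.mpr fun k hk =>
      mul_ne_zero (sub_ne_zero.mpr (hne k hk)) (by positivity)
  have hlt : |a - m| < a + m := abs_lt.mpr ⟨by linarith, by linarith⟩
  have h := congrArg abs (prod_Icc_shift_mul a m)
  rw [abs_mul, abs_mul, abs_of_pos (show 0 < a + m by positivity)] at h
  refine lt_of_mul_lt_mul_right ?_ (show 0 ≤ a + m by positivity)
  rw [← h]
  exact mul_lt_mul_of_pos_left hlt hQ


/-- For an admissible couple `(m, n)` (i.e. `0 < m`, `1 < n`, and `2m ≤ n` if `n` is even),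
one has `|p(λ_{i+1})| > |p(λ_i)|` for every natural `i`, where
`p(x) = ∏_{k=1}^{m} (x + (n/2 − k)(n/2 + k − 1))` and `λ_i = i(i + n − 1)`. -/
theorem stmt_3 (m n : ℕ) (hm : 0 < m) (hn : 1 < n) (hadm : Even n → 2 * m ≤ n) (i : ℕ) :
    |∏ k ∈ Finset.Icc 1 m,
        ((((i : ℝ) + 1) * ((i + 1 : ℝ) + n - 1)) + ((n : ℝ) / 2 - k) * ((n : ℝ) / 2 + k - 1))|
      > |∏ k ∈ Finset.Icc 1 m,
        (((i : ℝ) * (i + n - 1)) + ((n : ℝ) / 2 - k) * ((n : ℝ) / 2 + k - 1))| := by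
  have ha : (0 : ℝ) < i + n / 2 := by positivity
  have hne : ∀ k ∈ Finset.Icc 1 m, (i + n / 2 : ℝ) + 1 ≠ k := by
    intro k hk h
    have hk' := (Finset.mem_Icc.mp hk).2
    have h2 : 2 * i + n + 2 = 2 * k := by
      have : (2 * i + n + 2 : ℝ) = 2 * k := by linarith
      exact_mod_cast this
    have := hadm ⟨k - i - 1, by omega⟩
    omega
  refine lt_of_eq_of_lt (congrArg abs ?_) <|
    (abs_prod_Icc_lt_abs_prod_Icc_shift ha hm hne).trans_eq (congrArg abs ?_)
  all_goals exact Finset.prod_congr rfl fun k _ => by ring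
end

section
/- Let (m, n) be an admissible couple of positive integers, i.e. n > 1 and, in case n is even, n ≥ 2m. With p(x) = ∏_{k=1}^{m} (x + (n/2 − k)(n/2 + k − 1)) and λ_i = i(i + n − 1), for every natural number i ≠ 1 one has p(λ_i) ≠ p(λ_1). -/
/-- The polynomial `∏_{k=1}^{m} (a - k)(a + k - 1)`, which is `p(λ_i)` at `a = i + n/2`. -/
noncomputable def shiftedSymbol (m : ℕ) (a : ℝ) : ℝ :=
  ∏ k ∈ Finset.Icc 1 m, (a - k) * (a + k - 1)

theorem shiftedSymbol_add_one_mul (m : ℕ) (a : ℝ) :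
    shiftedSymbol m (a + 1) * (a - m) = shiftedSymbol m a * (a + m) := by
  induction m with
  | zero => simp [shiftedSymbol]
  | succ m ih =>
    simp only [shiftedSymbol, Finset.prod_Icc_succ_top (Nat.le_add_left 1 m)] at ih ⊢
    push_cast
    linear_combination (a - m - 1) * (a + m + 1) * ih

theorem abs_shiftedSymbol_lt_abs_shiftedSymbol_add_one {m : ℕ} {a : ℝ} (hm : 0 < m) (ha : 0 < a)
    (h : shiftedSymbol m (a + 1) ≠ 0) :
    |shiftedSymbol m a| < |shiftedSymbol m (a + 1)| := by
  have hm' : (0 : ℝ) < m := by exact_mod_cast hm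
  have hlt : |a - m| < a + m := abs_lt.2 ⟨by linarith, by linarith⟩
  refine lt_of_mul_lt_mul_right ?_ (by positivity : (0 : ℝ) ≤ a + m)
  calc |shiftedSymbol m a| * (a + m)
      = |shiftedSymbol m (a + 1)| * |a - m| := by
        rw [← abs_mul, shiftedSymbol_add_one_mul, abs_mul, abs_of_pos (by positivity : 0 < a + m)]
    _ < |shiftedSymbol m (a + 1)| * (a + m) := mul_lt_mul_of_pos_left hlt (abs_pos.2 h)

theorem shiftedSymbol_ne_zero {m n : ℕ} (hn : 1 < n) (hadm : Even n → 2 * m ≤ n) (i : ℕ) :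
    shiftedSymbol m ((i : ℝ) + n / 2 + 1) ≠ 0 := by
  refine Finset.prod_ne_zero_iff.2 fun k hk => mul_ne_zero (fun h => ?_) ?_
  · have h' : 2 * i + n + 2 = 2 * k := by
      have : (2 * i + n + 2 : ℝ) = 2 * k := by linarith
      exact_mod_cast this
    have := hadm ⟨k - i - 1, by omega⟩
    have := (Finset.mem_Icc.1 hk).2
    omega
  · have : (0 : ℝ) < n := by exact_mod_cast hn.trans' one_pos
    ring_nf
    positivity

theorem strictMono_abs_shiftedSymbol {m n : ℕ} (hm : 0 < m) (hn : 1 < n)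
    (hadm : Even n → 2 * m ≤ n) :
    StrictMono fun i : ℕ => |shiftedSymbol m ((i : ℝ) + n / 2)| := by
  refine strictMono_nat_of_lt_succ fun i => ?_
  have : (0 : ℝ) < n := by exact_mod_cast hn.trans' one_pos
  rw [Nat.cast_succ, add_right_comm]
  exact abs_shiftedSymbol_lt_abs_shiftedSymbol_add_one hm (by positivity)
    (shiftedSymbol_ne_zero hn hadm i)

/-- For an admissible couple `(m, n)` (i.e. `0 < m`, `1 < n`, and `2m ≤ n` if `n` is even),
one has `p(λ_i) ≠ p(λ_1)` for every natural `i ≠ 1`, where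
`p(x) = ∏_{k=1}^{m} (x + (n/2 − k)(n/2 + k − 1))` and `λ_i = i(i + n − 1)`. -/
theorem stmt_4 (m n : ℕ) (hm : 0 < m) (hn : 1 < n) (hadm : Even n → 2 * m ≤ n)
    (i : ℕ) (hi : i ≠ 1) :
    (∏ k ∈ Finset.Icc 1 m,
        (((i : ℝ) * (i + n - 1)) + ((n : ℝ) / 2 - k) * ((n : ℝ) / 2 + k - 1)))
      ≠ ∏ k ∈ Finset.Icc 1 m,
        (((1 : ℝ) * (1 + n - 1)) + ((n : ℝ) / 2 - k) * ((n : ℝ) / 2 + k - 1)) := by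
  have key (x : ℝ) : ∏ k ∈ Finset.Icc 1 m,
      ((x * (x + n - 1)) + ((n : ℝ) / 2 - k) * ((n : ℝ) / 2 + k - 1)) =
        shiftedSymbol m (x + n / 2) :=
    Finset.prod_congr rfl fun k _ => by ring
  rw [key, key]
  intro h
  refine hi ((strictMono_abs_shiftedSymbol hm hn hadm).injective ?_)
  simp only [Nat.cast_one, h]
end

section
/- Let m and n be positive integers. With p(x) = ∏_{k=1}^{m} (x + (n/2 − k)(n/2 + k − 1)) and λ_i = i(i + n − 1), for every natural number i ≥ 1 one has p(λ_i) · ∏_{k=0}^{i−1} (n/2 − m + k) = p(λ_0) · ∏_{k=0}^{i−1} (n/2 + m + k). -/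
/-- Raising `b` by one in `∏_{k=1}^{m} (b − k)(b + k − 1)` exchanges the factor `b − m` for
`b + m`. -/
theorem prod_Icc_shift {R : Type*} [CommRing R] (b : R) (m : ℕ) :
    (∏ k ∈ Finset.Icc 1 m, ((b + 1 - k) * (b + k))) * (b - m)
      = (∏ k ∈ Finset.Icc 1 m, ((b - k) * (b + k - 1))) * (b + m) := by
  induction m with
  | zero => simp
  | succ m ih =>
    rw [Finset.prod_Icc_succ_top (by lia), Finset.prod_Icc_succ_top (by lia)]
    push_cast
    linear_combination (b + m + 1) * (b - m - 1) * ih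

/-- The recursion in `i` of `prod_Icc_shift`, solved. -/
theorem prod_Icc_mul_prod_range {R : Type*} [CommRing R] (a : R) (m i : ℕ) :
    (∏ k ∈ Finset.Icc 1 m, ((a + i - k) * (a + i + k - 1))) * (∏ k ∈ Finset.range i, (a - m + k))
      = (∏ k ∈ Finset.Icc 1 m, ((a - k) * (a + k - 1)))
        * (∏ k ∈ Finset.range i, (a + m + k)) := by
  induction i with
  | zero => simp
  | succ i ih =>
    have h := prod_Icc_shift (a + i) m
    have hs : ∏ k ∈ Finset.Icc 1 m, ((a + (i + 1 : ℕ) - k) * (a + (i + 1 : ℕ) + k - 1))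
        = ∏ k ∈ Finset.Icc 1 m, ((a + i + 1 - k) * (a + i + k)) :=
      Finset.prod_congr rfl fun k _ => by push_cast; ring
    rw [hs, Finset.prod_range_succ, Finset.prod_range_succ]
    linear_combination (∏ k ∈ Finset.range i, (a - m + k)) * h + (a + m + i) * ih


/-- For every `i ≥ 1`,
`p(λ_i) · ∏_{k=0}^{i−1} (n/2 − m + k) = p(λ₀) · ∏_{k=0}^{i−1} (n/2 + m + k)`, where
`p(x) = ∏_{k=1}^{m} (x + (n/2 − k)(n/2 + k − 1))` and `λ_i = i(i + n − 1)`. -/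
theorem stmt_7 (m n : ℕ) (hm : 0 < m) (hn : 0 < n) (i : ℕ) (hi : 1 ≤ i) :
    (∏ k ∈ Finset.Icc 1 m,
        (((i : ℝ) * (i + n - 1)) + ((n : ℝ) / 2 - k) * ((n : ℝ) / 2 + k - 1)))
      * (∏ k ∈ Finset.range i, ((n : ℝ) / 2 - m + k))
    = (∏ k ∈ Finset.Icc 1 m,
        ((0 : ℝ) + ((n : ℝ) / 2 - k) * ((n : ℝ) / 2 + k - 1)))
      * (∏ k ∈ Finset.range i, ((n : ℝ) / 2 + m + k)) := by
  have h := prod_Icc_mul_prod_range ((n : ℝ) / 2) m i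
  have hs : ∏ k ∈ Finset.Icc 1 m,
        (((i : ℝ) * (i + n - 1)) + ((n : ℝ) / 2 - k) * ((n : ℝ) / 2 + k - 1))
      = ∏ k ∈ Finset.Icc 1 m, (((n : ℝ) / 2 + i - k) * ((n : ℝ) / 2 + i + k - 1)) :=
    Finset.prod_congr rfl fun k _ => by ring
  simpa only [hs, zero_add] using h
end

section
/- Let (m, n) be an admissible couple of positive integers, i.e. n > 1 and, in case n is even, n ≥ 2m. With p(x) = ∏_{k=1}^{m} (x + (n/2 − k)(n/2 + k − 1)) and λ_i = i(i + n − 1), for every natural number i ≥ 1 one has p(λ_i) ≠ 0. -/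
/-- For an admissible couple `(m, n)` (i.e. `0 < m`, `1 < n`, and `2m ≤ n` if `n` is even),
one has `p(λ_i) ≠ 0` for every `i ≥ 1`, where
`p(x) = ∏_{k=1}^{m} (x + (n/2 − k)(n/2 + k − 1))` and `λ_i = i(i + n − 1)`. -/
theorem stmt_8 (m n : ℕ) (hm : 0 < m) (hn : 1 < n) (hadm : Even n → 2 * m ≤ n)
    (i : ℕ) (hi : 1 ≤ i) :
    (∏ k ∈ Finset.Icc 1 m,
        (((i : ℝ) * (i + n - 1)) + ((n : ℝ) / 2 - k) * ((n : ℝ) / 2 + k - 1))) ≠ 0 := by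
  rw [Finset.prod_ne_zero_iff]
  intro k hk
  obtain ⟨hk1, hkm⟩ := Finset.mem_Icc.mp hk
  have hfactor : (i : ℝ) * (i + n - 1) + ((n : ℝ) / 2 - k) * ((n : ℝ) / 2 + k - 1) =
      (i + n / 2 - k) * (i + n / 2 + k - 1) := by ring
  rw [hfactor]
  refine mul_ne_zero (fun h => ?_) (fun h => ?_)
  · have hnat : 2 * i + n = 2 * k := by
      have hreal : (2 * i + n : ℝ) = 2 * k := by linarith
      exact_mod_cast hreal
    have := hadm (by rw [Nat.even_iff]; omega)
    omega
  · have hnat : 2 * i + n + 2 * k = 2 := by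
      have hreal : (2 * i + n + 2 * k : ℝ) = 2 := by linarith
      exact_mod_cast hreal
    omega
end
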